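/- arXiv:1609.00820 — 6 statements merged into one kernel-verified Lean document; each statement's English description precedes it below -/
import Mathlib

section
/- Let G be a group and S a set of subgroups of G such that every member of S is contained in a member of S that is maximal in S with respect to inclusion. Define a relation ∼ on S by: H ∼ K if and only if there exists L ∈ S with L ≤ H and L ≤ K. Then the following are equivalent: (i) ∼ is transitive; (ii) for every H ∈ S, the set {K ∈ S : K ≤ H} is downward-directed with respect to inclusion; (iii) for every H ∈ S that is maximal in S, the set {K ∈ S : K ≤ H} is downward-directed with respect to inclusion. -/
/-- Let `S` be a set of subgroups of `G` such that every member of `S` is contained in a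
member of `S` that is maximal in `S`. For the relation `H ∼ K ↔ ∃ L ∈ S, L ≤ H ∧ L ≤ K`
on `S`, the following are equivalent: (i) `∼` is transitive; (ii) every down-set
`{K ∈ S | K ≤ H}` (`H ∈ S`) is downward-directed; (iii) every down-set of a maximal
member of `S` is downward-directed. -/
theorem sim_transitive_iff_directed {G : Type*} [Group G] (S : Set (Subgroup G))
    (hmax : ∀ H ∈ S, ∃ M ∈ S, H ≤ M ∧ ∀ K ∈ S, M ≤ K → K = M) :
    ((∀ H ∈ S, ∀ K ∈ S, ∀ M ∈ S,
        (∃ L ∈ S, L ≤ H ∧ L ≤ K) → (∃ L ∈ S, L ≤ K ∧ L ≤ M) → (∃ L ∈ S, L ≤ H ∧ L ≤ M)) ↔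
      (∀ H ∈ S, ∀ K₁ ∈ S, ∀ K₂ ∈ S, K₁ ≤ H → K₂ ≤ H →
        ∃ L ∈ S, L ≤ K₁ ∧ L ≤ K₂)) ∧
    ((∀ H ∈ S, ∀ K₁ ∈ S, ∀ K₂ ∈ S, K₁ ≤ H → K₂ ≤ H →
        ∃ L ∈ S, L ≤ K₁ ∧ L ≤ K₂) ↔
      (∀ H ∈ S, (∀ K ∈ S, H ≤ K → K = H) → ∀ K₁ ∈ S, ∀ K₂ ∈ S, K₁ ≤ H → K₂ ≤ H →
        ∃ L ∈ S, L ≤ K₁ ∧ L ≤ K₂)) := by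
  refine ⟨⟨fun h H hH K₁ h₁ K₂ h₂ hK₁ hK₂ => ?_, fun h H _ K hK M _ => ?_⟩,
    fun h H hH _ => h H hH, fun h H hH K₁ h₁ K₂ h₂ hK₁ hK₂ => ?_⟩
  · exact h K₁ h₁ H hH K₂ h₂ ⟨K₁, h₁, le_rfl, hK₁⟩ ⟨K₂, h₂, hK₂, le_rfl⟩
  · rintro ⟨L₁, h₁, hL₁H, hL₁K⟩ ⟨L₂, h₂, hL₂K, hL₂M⟩
    obtain ⟨L, hL, hL₁, hL₂⟩ := h K hK L₁ h₁ L₂ h₂ hL₁K hL₂K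
    exact ⟨L, hL, hL₁.trans hL₁H, hL₂.trans hL₂M⟩
  · obtain ⟨M, hM, hHM, hMmax⟩ := hmax H hH
    exact h M hM hMmax K₁ h₁ K₂ h₂ (hK₁.trans hHM) (hK₂.trans hHM)
end

section
/- Let G be a group and a ∈ G. Assume: (h1) the abelianization G/[G,G] is infinite cyclic, generated by the image of a; (h2) for every nonzero integer n, the centralizer of aⁿ in G equals the centralizer of a in G. Then for every t ∈ G, the following are equivalent: (1) there exist nonzero integers i, j with t⁻¹ a^i t = a^j; (2) t lies in the centralizer C_G(a) of a. Consequently the set N = { t ∈ G : ⟨t⁻¹ a t⟩ ∩ ⟨a⟩ ≠ {1} } equals C_G(a). -/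
/-- A nontrivial common element of `⟨t⁻¹ a t⟩` and `⟨a⟩` is a conjugate of a nonzero power of `a`
that is again a nonzero power of `a`; the converse holds when `a` has infinite order. -/
theorem zpowers_conj_inf_zpowers_ne_bot_iff {G : Type*} [Group G] {a : G}
    (ha : ¬ IsOfFinOrder a) (t : G) :
    Subgroup.zpowers (t⁻¹ * a * t) ⊓ Subgroup.zpowers a ≠ ⊥ ↔
      ∃ i j : ℤ, i ≠ 0 ∧ j ≠ 0 ∧ t⁻¹ * a ^ i * t = a ^ j := by
  have conj_zpow' (i : ℤ) : (t⁻¹ * a * t) ^ i = t⁻¹ * a ^ i * t := by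
    simpa using conj_zpow (i := i) (a := t⁻¹) (b := a)
  rw [Subgroup.ne_bot_iff_exists_ne_one]
  constructor
  · rintro ⟨⟨z, hz, hz'⟩, hne⟩
    obtain ⟨i, rfl⟩ := Subgroup.mem_zpowers_iff.1 hz
    obtain ⟨j, hj⟩ := Subgroup.mem_zpowers_iff.1 hz'
    have hne' : (t⁻¹ * a * t) ^ i ≠ 1 := fun h => hne (Subtype.ext h)
    refine ⟨i, j, ?_, ?_, by rw [← conj_zpow', hj]⟩
    · rintro rfl
      exact hne' (zpow_zero _)
    · rintro rfl
      exact hne' (by rw [← hj, zpow_zero])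
  · rintro ⟨i, j, -, hj, h⟩
    refine ⟨⟨a ^ j, Subgroup.mem_inf.2 ⟨?_, Subgroup.zpow_mem_zpowers a j⟩⟩, fun h1 => hj ?_⟩
    · exact Subgroup.mem_zpowers_iff.2 ⟨i, by rw [conj_zpow', h]⟩
    · refine injective_zpow_iff_not_isOfFinOrder.2 ha ?_
      simpa using congrArg Subtype.val h1

/-- Conjugate powers of `a` have equal exponents if the image of `a` in the abelianization has
infinite order. -/
theorem eq_of_conj_zpow_eq_zpow {G : Type*} [Group G] {a t : G}
    (ha : ¬ IsOfFinOrder (Abelianization.of a)) {i j : ℤ} (h : t⁻¹ * a ^ i * t = a ^ j) :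
    i = j := by
  refine injective_zpow_iff_not_isOfFinOrder.2 ha ?_
  simpa [mul_right_comm] using congrArg Abelianization.of h


/-- If the abelianization of `G` is infinite cyclic generated by the image of `a`, and the
centralizer of every nonzero power of `a` equals the centralizer of `a`, then for every
`t ∈ G`: `t⁻¹ aⁱ t = aʲ` for some nonzero `i, j` iff `t` centralizes `a`. Consequently
`N = {t | ⟨t⁻¹ a t⟩ ∩ ⟨a⟩ ≠ 1}` equals `C_G(a)`. -/
theorem normalizer_of_class_eq_centralizer {G : Type*} [Group G] (a : G)
    (h1a : ∀ x : Abelianization G, x ∈ Subgroup.zpowers (Abelianization.of a))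
    (h1b : ¬ IsOfFinOrder (Abelianization.of a))
    (h2 : ∀ n : ℤ, n ≠ 0 → Subgroup.centralizer {a ^ n} = Subgroup.centralizer {a}) :
    (∀ t : G,
      (∃ i j : ℤ, i ≠ 0 ∧ j ≠ 0 ∧ t⁻¹ * a ^ i * t = a ^ j) ↔ t ∈ Subgroup.centralizer {a}) ∧
    {t : G | Subgroup.zpowers (t⁻¹ * a * t) ⊓ Subgroup.zpowers a ≠ ⊥} =
      (Subgroup.centralizer {a} : Set G) := by
  have key (t : G) : (∃ i j : ℤ, i ≠ 0 ∧ j ≠ 0 ∧ t⁻¹ * a ^ i * t = a ^ j) ↔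
      t ∈ Subgroup.centralizer {a} := by
    constructor
    · rintro ⟨i, j, hi, -, h⟩
      obtain rfl := eq_of_conj_zpow_eq_zpow h1b h
      rw [← h2 i hi, Subgroup.mem_centralizer_singleton_iff]
      rw [mul_assoc, inv_mul_eq_iff_eq_mul] at h
      exact h.symm
    · intro ht
      rw [Subgroup.mem_centralizer_singleton_iff] at ht
      exact ⟨1, 1, one_ne_zero, one_ne_zero, by rw [zpow_one, mul_assoc, ← ht, inv_mul_cancel_left]⟩
  have ha : ¬ IsOfFinOrder a := fun h => h1b (Abelianization.of.isOfFinOrder h)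
  exact ⟨key, Set.ext fun t => (zpowers_conj_inf_zpowers_ne_bot_iff ha t).trans (key t)⟩
end

section
/- Let G be a group and a ∈ G. Assume: (h1) the abelianization G/[G,G] is infinite cyclic, generated by the image of a; (h2) for every nonzero integer n, the centralizer of aⁿ in G equals the centralizer of a in G. Then for every t ∈ G and every nonzero integer k, if ⟨t⁻¹ a^k t⟩ ∩ ⟨a⟩ ≠ {1}, then ⟨t⁻¹ a^k t⟩ = ⟨a^k⟩; in particular ⟨t⁻¹ a^k t⟩ ≤ ⟨a⟩. -/
/-- If the abelianization of `G` is infinite cyclic generated by the image of `a`, and the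
centralizer of every nonzero power of `a` equals the centralizer of `a`, then for `t ∈ G`
and a nonzero integer `k`, if `⟨t⁻¹ aᵏ t⟩ ∩ ⟨a⟩` is nontrivial then
`⟨t⁻¹ aᵏ t⟩ = ⟨aᵏ⟩`; in particular `⟨t⁻¹ aᵏ t⟩ ≤ ⟨a⟩`. -/
theorem family_class_eq_subgroups_of_meridian {G : Type*} [Group G] (a : G)
    (h1a : ∀ x : Abelianization G, x ∈ Subgroup.zpowers (Abelianization.of a))
    (h1b : ¬ IsOfFinOrder (Abelianization.of a))
    (h2 : ∀ n : ℤ, n ≠ 0 → Subgroup.centralizer {a ^ n} = Subgroup.centralizer {a}) :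
    ∀ t : G, ∀ k : ℤ, k ≠ 0 →
      Subgroup.zpowers (t⁻¹ * a ^ k * t) ⊓ Subgroup.zpowers a ≠ ⊥ →
      Subgroup.zpowers (t⁻¹ * a ^ k * t) = Subgroup.zpowers (a ^ k) ∧
        Subgroup.zpowers (t⁻¹ * a ^ k * t) ≤ Subgroup.zpowers a := by
  intro t k _ hne
  obtain ⟨g, ⟨⟨m, hm⟩, n, hn⟩, hg⟩ := (Subgroup.bot_or_exists_ne_one _).resolve_left hne
  have hn0 : n ≠ 0 := by
    rintro rfl
    exact hg (by simpa using hn.symm)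
  have hconj : t⁻¹ * a ^ (k * m) * t = a ^ n := by
    have h := conj_zpow (i := m) (a := t⁻¹) (b := a ^ k)
    rw [inv_inv, ← zpow_mul] at h
    exact h.symm.trans (hm.trans hn.symm)
  have hkm : k * m = n := by
    have h := congrArg Abelianization.of hconj
    rw [map_mul, map_mul, map_inv, mul_right_comm, inv_mul_cancel, one_mul, map_zpow,
      map_zpow] at h
    exact injective_zpow_iff_not_isOfFinOrder.mpr h1b h
  have ht : t ∈ Subgroup.centralizer {a} := by
    rw [← h2 n hn0, Subgroup.mem_centralizer_singleton_iff]
    rw [hkm, mul_assoc, inv_mul_eq_iff_eq_mul] at hconj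
    exact hconj.symm
  have hcomm : Commute t (a ^ k) :=
    Commute.zpow_right (Subgroup.mem_centralizer_singleton_iff.mp ht) k
  have hfix : t⁻¹ * a ^ k * t = a ^ k := by
    rw [mul_assoc, ← hcomm.eq, inv_mul_cancel_left]
  rw [hfix]
  exact ⟨rfl, Subgroup.zpowers_le.mpr (Subgroup.zpow_mem_zpowers a k)⟩
end

section
/- Let G be a group and a ∈ G. Assume: (h1) the abelianization G/[G,G] is infinite cyclic, generated by the image of a; (h2) for every nonzero integer n, the centralizer of aⁿ in G equals the centralizer of a in G. Then every nontrivial conjugate of a cyclic subgroup generated by a power of a is contained in a unique maximal such subgroup; explicitly, for all g, h ∈ G, if ⟨g⁻¹ a g⟩ ∩ ⟨h⁻¹ a h⟩ ≠ {1} then ⟨g⁻¹ a g⟩ = ⟨h⁻¹ a h⟩. -/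
/-- If the abelianization of `G` is infinite cyclic generated by the image of `a`, and the
centralizer of every nonzero power of `a` equals the centralizer of `a`, then any two
conjugates of `⟨a⟩` that intersect nontrivially coincide: each nontrivial member of the
family generated by `a` lies in a unique maximal one. -/
theorem unique_maximal_conjugate {G : Type*} [Group G] (a : G)
    (h1a : ∀ x : Abelianization G, x ∈ Subgroup.zpowers (Abelianization.of a))
    (h1b : ¬ IsOfFinOrder (Abelianization.of a))
    (h2 : ∀ n : ℤ, n ≠ 0 → Subgroup.centralizer {a ^ n} = Subgroup.centralizer {a}) :
    ∀ g h : G,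
      Subgroup.zpowers (g⁻¹ * a * g) ⊓ Subgroup.zpowers (h⁻¹ * a * h) ≠ ⊥ →
      Subgroup.zpowers (g⁻¹ * a * g) = Subgroup.zpowers (h⁻¹ * a * h) := by
  intro g h hne
  have conj (k : G) (i : ℤ) : (k⁻¹ * a * k) ^ i = k⁻¹ * a ^ i * k := by
    simpa using conj_zpow (i := i) (a := k⁻¹) (b := a)
  obtain ⟨x, hx, hx1⟩ := (Subgroup.bot_or_exists_ne_one _).resolve_left hne
  obtain ⟨⟨m, hm⟩, ⟨n, hn⟩⟩ := Subgroup.mem_inf.1 hx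
  simp only [conj] at hm hn
  have hmn : m = n := by
    apply injective_zpow_iff_not_isOfFinOrder.2 h1b
    have := congrArg Abelianization.of (hm.trans hn.symm)
    simpa [mul_comm] using this
  subst hmn
  have hm0 : m ≠ 0 := by
    rintro rfl
    exact hx1 (by simpa using hm.symm)
  have hk : h * g⁻¹ ∈ Subgroup.centralizer {a ^ m} := by
    rw [Subgroup.mem_centralizer_singleton_iff]
    have := congrArg (fun y => h * y * g⁻¹) (hm.trans hn.symm)
    simpa [mul_assoc] using this
  rw [h2 m hm0, Subgroup.mem_centralizer_singleton_iff] at hk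
  have := congrArg (fun y => h⁻¹ * y * g) hk
  have hgh : g⁻¹ * a * g = h⁻¹ * a * h := by simpa [mul_assoc] using this
  rw [hgh]
end

section
/- Let G be a group and m, l ∈ G with ml = lm, and let R = ℤ[G] be the integral group ring. Define the chain complex Q: 0 → R →^{δ₂} R ⊕ R →^{δ₁} R → 0 (generators denoted r̲; m̲, l̲; 0̲) by δ₂(r̲) = ((1−l)·m̲-component, (m−1)·l̲-component), i.e. δ₂(x) = ((1−l)x, (m−1)x), and δ₁(x, y) = (m−1)x + (l−1)y; and define the complex Q^⊛: 0 → R →^{δ₂^⊛} R ⊕ R →^{δ₁^⊛} R → 0 (generators 0̲*; m̲*, l̲*; r̲*) by δ₂^⊛(x) = ((m⁻¹−1)x, (l⁻¹−1)x) and δ₁^⊛(x, y) = (1−l⁻¹)x + (m⁻¹−1)y. Then the R-linear maps ζ₂: r̲ ↦ −ml·0̲*, ζ₁: m̲ ↦ −m·l̲*, l̲ ↦ l·m̲*, ζ₀: 0̲ ↦ r̲* form a chain map ζ: Q → Q^⊛ which is an isomorphism of chain complexes, with inverse given by ζ₀⁻¹: r̲* ↦ 0̲, ζ₁⁻¹: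 m̲* ↦ l⁻¹·l̲, l̲* ↦ −m⁻¹·m̲, ζ₂⁻¹: 0̲* ↦ −l⁻¹m⁻¹·r̲. -/
section TorusDuality

variable {A : Type*} [Ring A] {M L Mi Li : A}

theorem torusDuality_comm_two (hc : M * L = L * M) (hM : Mi * M = 1) (hL : Li * L = 1) (x : A) :
    (L * ((M - 1) * x), -(M * ((1 - L) * x))) =
      ((Mi - 1) * -(M * L * x), (Li - 1) * -(M * L * x)) := by
  have h₁ : Mi * (M * L) = L := by rw [← mul_assoc, hM, one_mul]
  have h₂ : Li * (M * L) = M := by rw [hc, ← mul_assoc, hL, one_mul]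
  ext1
  · calc L * ((M - 1) * x) = (L * M - L) * x := by noncomm_ring
      _ = (M * L - Mi * (M * L)) * x := by rw [h₁, hc]
      _ = (Mi - 1) * -(M * L * x) := by noncomm_ring
  · calc -(M * ((1 - L) * x)) = (M * L - M) * x := by noncomm_ring
      _ = (M * L - Li * (M * L)) * x := by rw [h₂]
      _ = (Li - 1) * -(M * L * x) := by noncomm_ring

theorem torusDuality_comm_one (hM : Mi * M = 1) (hL : Li * L = 1) (x y : A) :
    (M - 1) * x + (L - 1) * y = (1 - Li) * (L * y) + (Mi - 1) * -(M * x) := by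
  calc (M - 1) * x + (L - 1) * y = (M - Mi * M) * x + (L - Li * L) * y := by rw [hM, hL]
    _ = (1 - Li) * (L * y) + (Mi - 1) * -(M * x) := by noncomm_ring

theorem neg_mul_neg_mul_cancel {a b : A} (h : a * b = 1) (x : A) : -(a * -(b * x)) = x := by
  rw [mul_neg, neg_neg, ← mul_assoc, h, one_mul]

end TorusDuality


/-- For commuting elements `m, l` of a group `G` and `R = ℤ[G]`, the maps
`ζ₂ : r̲ ↦ −ml·0̲*`, `ζ₁ : m̲ ↦ −m·l̲*, l̲ ↦ l·m̲*`, `ζ₀ : 0̲ ↦ r̲*` form a chain map from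
the complex `Q : 0 → R → R ⊕ R → R → 0` (with `δ₂(x) = ((1−l)x, (m−1)x)`,
`δ₁(x,y) = (m−1)x + (l−1)y`) to its twisted dual `Q^⊛` (with
`δ₂^⊛(x) = ((m⁻¹−1)x, (l⁻¹−1)x)`, `δ₁^⊛(x,y) = (1−l⁻¹)x + (m⁻¹−1)y`), and this chain
map is an isomorphism of chain complexes with the indicated inverse. -/
theorem torus_selfduality_chain_iso {G : Type*} [Group G] (m l : G)
    (hml : m * l = l * m) :
    let R := MonoidAlgebra ℤ G
    let M : R := MonoidAlgebra.of ℤ G m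
    let L : R := MonoidAlgebra.of ℤ G l
    let Mi : R := MonoidAlgebra.of ℤ G m⁻¹
    let Li : R := MonoidAlgebra.of ℤ G l⁻¹
    let δ₂ : R → R × R := fun x => ((1 - L) * x, (M - 1) * x)
    let δ₁ : R × R → R := fun p => (M - 1) * p.1 + (L - 1) * p.2
    let δ₂s : R → R × R := fun x => ((Mi - 1) * x, (Li - 1) * x)
    let δ₁s : R × R → R := fun p => (1 - Li) * p.1 + (Mi - 1) * p.2
    let ζ₂ : R → R := fun x => -(M * L * x)
    let ζ₁ : R × R → R × R := fun p => (L * p.2, -(M * p.1))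
    let ζ₀ : R → R := fun x => x
    let ζ₂i : R → R := fun x => -(Li * Mi * x)
    let ζ₁i : R × R → R × R := fun p => (-(Mi * p.2), Li * p.1)
    let ζ₀i : R → R := fun x => x
    -- ζ is a chain map
    (∀ x : R, ζ₁ (δ₂ x) = δ₂s (ζ₂ x)) ∧
    (∀ p : R × R, ζ₀ (δ₁ p) = δ₁s (ζ₁ p)) ∧
    -- ζ is an isomorphism of chain complexes, with inverse ζ⁻¹
    (∀ x : R, ζ₂i (ζ₂ x) = x) ∧ (∀ x : R, ζ₂ (ζ₂i x) = x) ∧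
    (∀ p : R × R, ζ₁i (ζ₁ p) = p) ∧ (∀ p : R × R, ζ₁ (ζ₁i p) = p) ∧
    (∀ x : R, ζ₀i (ζ₀ x) = x) ∧ (∀ x : R, ζ₀ (ζ₀i x) = x) ∧
    -- ζ⁻¹ is also a chain map
    (∀ x : R, ζ₁i (δ₂s x) = δ₂ (ζ₂i x)) ∧
    (∀ p : R × R, ζ₀i (δ₁s p) = δ₁ (ζ₁i p)) := by
  intro R M L Mi Li δ₂ δ₁ δ₂s δ₁s ζ₂ ζ₁ ζ₀ ζ₂i ζ₁i ζ₀i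
  have hc : M * L = L * M := by simp only [M, L, ← map_mul, hml]
  have hM : M * Mi = 1 := by simp only [M, Mi, ← map_mul, mul_inv_cancel, map_one]
  have hM' : Mi * M = 1 := by simp only [M, Mi, ← map_mul, inv_mul_cancel, map_one]
  have hL : L * Li = 1 := by simp only [L, Li, ← map_mul, mul_inv_cancel, map_one]
  have hL' : Li * L = 1 := by simp only [L, Li, ← map_mul, inv_mul_cancel, map_one]
  have hML : (M * L) * (Li * Mi) = 1 := by rw [mul_assoc, ← mul_assoc L, hL, one_mul, hM]
  have hML' : (Li * Mi) * (M * L) = 1 := by rw [mul_assoc, ← mul_assoc Mi, hM', one_mul, hL']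
  have h₂ : ∀ x, ζ₁ (δ₂ x) = δ₂s (ζ₂ x) := torusDuality_comm_two hc hM' hL'
  have h₁ : ∀ p, ζ₀ (δ₁ p) = δ₁s (ζ₁ p) := fun p => torusDuality_comm_one hM' hL' p.1 p.2
  have right₂ : ∀ x, ζ₂ (ζ₂i x) = x := neg_mul_neg_mul_cancel hML
  have left₁ : ∀ p, ζ₁i (ζ₁ p) = p := fun p =>
    Prod.ext (neg_mul_neg_mul_cancel hM' p.1)
      (show Li * (L * p.2) = p.2 by rw [← mul_assoc, hL', one_mul])
  have right₁ : ∀ p, ζ₁ (ζ₁i p) = p := fun p =>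
    Prod.ext (show L * (Li * p.1) = p.1 by rw [← mul_assoc, hL, one_mul])
      (neg_mul_neg_mul_cancel hM p.2)
  refine ⟨h₂, h₁, neg_mul_neg_mul_cancel hML', right₂, left₁, right₁, fun _ => rfl,
    fun _ => rfl, fun x => ?_, fun p => ?_⟩
  · rw [← left₁ (δ₂ (ζ₂i x)), h₂, right₂]
  · change δ₁s p = ζ₀ (δ₁ (ζ₁i p))
    rw [h₁, right₁]
end

section
/- Let G be a group, H₁, …, H_c subgroups of G, and a_i ∈ H_i elements such that G is generated by the set of all conjugates of a₁, …, a_c. Let U be a normal subgroup of G of finite index. Then U = G if and only if for every i = 1, …, c the index |G : U H_i| equals |G : U| (where U H_i denotes the join of U and H_i, a subgroup since U is normal). -/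
/-- Let `G` be generated by all conjugates of elements `a i ∈ H i`, and let `U` be a
normal subgroup of finite index. Then `U = G` iff `|G : U ⊔ H i| = |G : U|` for all `i`. -/
theorem eq_top_iff_index_join_eq {G : Type*} [Group G] {c : ℕ}
    (H : Fin c → Subgroup G) (a : Fin c → G) (ha : ∀ i, a i ∈ H i)
    (hgen : Subgroup.normalClosure (Set.range a) = ⊤)
    (U : Subgroup G) [U.Normal] (hU : U.index ≠ 0) :
    U = ⊤ ↔ ∀ i, (U ⊔ H i).index = U.index := by
  refine ⟨fun h i => by simp [h], fun h => ?_⟩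
  rw [eq_top_iff, ← hgen]
  refine Subgroup.normalClosure_le_normal ?_
  rintro _ ⟨i, rfl⟩
  have hrel : U.relIndex (U ⊔ H i) = 1 := by
    have hmul := Subgroup.relIndex_mul_index (le_sup_left : U ≤ U ⊔ H i)
    rw [h i] at hmul
    exact (mul_eq_right₀ hU).mp hmul
  exact Subgroup.relIndex_eq_one.mp hrel (Subgroup.mem_sup_right (ha i))
end
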